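/- arXiv:2310.05893 — 6 statements merged into one kernel-verified Lean document; each statement's English description precedes it below -/
import Mathlib

section
/- Let x̄ be a feasible assignment and x' any feasible assignment. The combined distance between x' and x̄ is at most 4 if and only if x' = x̄, or x' is obtained from x̄ by an internal swap, or x' is obtained from x̄ by a starting-job shift. -/
section Scheduling

variable {n : ℕ} {M : Type*}

/-- An assignment `x : Fin n → Fin n → M → Bool`, where `x i j m = true` means that
job `j` occupies slot `i` of machine `m`, is *feasible* if: (c1) every job occupies
exactly one slot of one machine; (c2) every slot of every machine holds at most one
job; (c7) on each machine, if slot `i` is occupied then so is slot `i+1`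
(empty slots appear first). -/
def Feasible (x : Fin n → Fin n → M → Bool) : Prop :=
  (∀ j : Fin n, ∃! p : Fin n × M, x p.1 j p.2 = true) ∧
  (∀ (i : Fin n) (m : M) (j j' : Fin n), x i j m = true → x i j' m = true → j = j') ∧
  (∀ (m : M) (i : Fin n) (hi : i.val + 1 < n),
    (∃ j, x i j m = true) → ∃ j, x ⟨i.val + 1, hi⟩ j m = true)

/-- The machine indicator of an assignment: `yOf x j m = true` iff job `j` is
assigned to (some slot of) machine `m`. -/
def yOf (x : Fin n → Fin n → M → Bool) : Fin n → M → Bool :=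
  fun j m => decide (∃ i, x i j m = true)

/-- The x-distance: number of triples `(i, j, m)` on which the two assignments differ. -/
def xDist [Fintype M] (x x' : Fin n → Fin n → M → Bool) : ℕ :=
  ((Finset.univ : Finset (Fin n × Fin n × M)).filter
    (fun t => x t.1 t.2.1 t.2.2 ≠ x' t.1 t.2.1 t.2.2)).card

/-- The y-distance: number of pairs `(j, m)` on which the machine indicators differ. -/
def yDist [Fintype M] (x x' : Fin n → Fin n → M → Bool) : ℕ :=
  ((Finset.univ : Finset (Fin n × M)).filter
    (fun t => yOf x t.1 t.2 ≠ yOf x' t.1 t.2)).card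

/-- The combined distance: x-distance plus y-distance. -/
def combDist [Fintype M] (x x' : Fin n → Fin n → M → Bool) : ℕ :=
  xDist x x' + yDist x x'

/-- `x'` is obtained from `xb` by an *internal swap*: two distinct jobs `j ≠ j'`
occupying distinct slots `i, i'` of the same machine `m` exchange their slots. -/
def IsInternalSwap [DecidableEq M] (xb x' : Fin n → Fin n → M → Bool) : Prop :=
  ∃ (i i' j j' : Fin n) (m : M), i ≠ i' ∧ j ≠ j' ∧
    xb i j m = true ∧ xb i' j' m = true ∧
    x' = fun a b c =>
      if (a, b, c) = (i, j, m) then false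
      else if (a, b, c) = (i', j', m) then false
      else if (a, b, c) = (i', j, m) then true
      else if (a, b, c) = (i, j', m) then true
      else xb a b c

/-- `x'` is obtained from `xb` by a *starting-job shift*: the job `j` occupying the
smallest occupied slot `i` of machine `m` is moved to the slot `i'` of a different
machine `m'` immediately preceding the smallest occupied slot of `m'` (equivalently,
under (c7), `i'` is empty on `m'` and every later slot of `m'` is occupied;
`i' = n - 1` if `m'` has no occupied slot). -/
def IsStartShift [DecidableEq M] (xb x' : Fin n → Fin n → M → Bool) : Prop :=
  ∃ (m m' : M) (i i' j : Fin n), m ≠ m' ∧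
    xb i j m = true ∧
    (∀ (i₀ j₀ : Fin n), xb i₀ j₀ m = true → i ≤ i₀) ∧
    (∀ j₀ : Fin n, xb i' j₀ m' = false) ∧
    (∀ i₀ : Fin n, i' < i₀ → ∃ j₀, xb i₀ j₀ m' = true) ∧
    x' = fun a b c =>
      if (a, b, c) = (i, j, m) then false
      else if (a, b, c) = (i', j, m') then true
      else xb a b c

/-- `x'` is obtained from `xb` by an *internal `h`-swap* (`h ≥ 2`): `h` distinct jobs
`jb 0, …, jb (h-1)` occupying `h` distinct slots `sl 0, …, sl (h-1)` of the same
machine `m` rotate, job `jb l` moving to slot `sl ((l + 1) % h)`. -/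
def IsInternalHSwap [DecidableEq M] (h : ℕ) (xb x' : Fin n → Fin n → M → Bool) : Prop :=
  ∃ (hh : 2 ≤ h) (m : M) (jb sl : Fin h → Fin n),
    Function.Injective jb ∧ Function.Injective sl ∧
    (∀ l, xb (sl l) (jb l) m = true) ∧
    x' = fun a b c =>
      if c = m ∧ ∃ l : Fin h, a = sl l ∧ b = jb l then false
      else if c = m ∧ ∃ l : Fin h,
          a = sl ⟨(l.val + 1) % h, Nat.mod_lt _ (by omega)⟩ ∧ b = jb l then true
      else xb a b c

/-- `x'` is obtained from `xb` by an *external swap*: jobs `j ≠ j'` occupying slot `i`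
of machine `m` and slot `i'` of a different machine `m'` exchange their positions. -/
def IsExternalSwap [DecidableEq M] (xb x' : Fin n → Fin n → M → Bool) : Prop :=
  ∃ (i i' j j' : Fin n) (m m' : M), j ≠ j' ∧ m ≠ m' ∧
    xb i j m = true ∧ xb i' j' m' = true ∧
    x' = fun a b c =>
      if (a, b, c) = (i, j, m) then false
      else if (a, b, c) = (i', j', m') then false
      else if (a, b, c) = (i', j, m') then true
      else if (a, b, c) = (i, j', m) then true
      else xb a b c

end Scheduling

/-- `Locates f x` says that `f` sends each job to the (slot, machine) pair it occupies in `x`. -/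
def Locates {n : ℕ} {M : Type*} (f : Fin n → Fin n × M) (x : Fin n → Fin n → M → Bool) : Prop :=
  ∀ i j m, x i j m = true ↔ f j = (i, m)

theorem Feasible.exists_locates {n : ℕ} {M : Type*} {x : Fin n → Fin n → M → Bool}
    (hx : Feasible x) : ∃ f, Locates f x := by
  choose f hf hf' using hx.1
  refine ⟨f, fun i j m => ⟨fun h => (hf' j (i, m) h).symm, fun h => ?_⟩⟩
  have := hf j
  rwa [h] at this

namespace Locates

variable {n : ℕ} {M : Type*} {f g : Fin n → Fin n × M} {x x' : Fin n → Fin n → M → Bool}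

theorem injective (hf : Locates f x) (hx : Feasible x) : Function.Injective f := fun j j' h =>
  hx.2.1 (f j).1 (f j).2 j j' ((hf _ _ _).2 rfl) ((hf _ _ _).2 h.symm)

theorem exists_of_le (hf : Locates f x) (hx : Feasible x) {j i k : Fin n} {m : M}
    (hj : f j = (i, m)) (hik : i ≤ k) : ∃ j', f j' = (k, m) := by
  have key : ∀ d (hd : i.val + d < n), ∃ j', f j' = (⟨i.val + d, hd⟩, m) := by
    intro d
    induction d with
    | zero => exact fun _ => ⟨j, hj⟩
    | succ d ih =>
      intro hd
      obtain ⟨j', hj'⟩ := ih (by omega)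
      obtain ⟨l, hl⟩ := hx.2.2 m ⟨i.val + d, by omega⟩ hd ⟨j', (hf _ _ _).2 hj'⟩
      exact ⟨l, (hf _ _ _).1 hl⟩
  obtain ⟨j', hj'⟩ := key (k.val - i.val) (by omega)
  refine ⟨j', hj'.trans ?_⟩
  congr 1
  ext
  have : i.val ≤ k.val := hik
  simp only
  omega

theorem eq_of_eq (hf : Locates f x) (hg : Locates f x') : x = x' := by
  funext i j m
  rw [Bool.eq_iff_iff, hf, hg]

theorem yOf_iff (hf : Locates f x) (j : Fin n) (m : M) : yOf x j m = true ↔ (f j).2 = m := by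
  simp only [yOf, decide_eq_true_eq, hf _ _ _]
  exact ⟨fun ⟨i, h⟩ => by rw [h], fun h => ⟨(f j).1, by rw [← h]⟩⟩

/-- If no job changes machine, the two assignments occupy the same slots. -/
theorem exists_eq_of_snd_eq (hf : Locates f x) (hg : Locates g x') (hx : Feasible x)
    (hx' : Feasible x') (h : ∀ j, (f j).2 = (g j).2) (j : Fin n) : ∃ j', f j' = g j := by
  classical
  let J := Finset.univ.filter fun l => (f l).2 = (g j).2
  let A := J.image fun l => (f l).1
  let B := J.image fun l => (g l).1
  have memA : ∀ i, i ∈ A ↔ ∃ l, f l = (i, (g j).2) := fun i => by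
    simp [A, J, Prod.ext_iff, and_comm]
  have memB : ∀ i, i ∈ B ↔ ∃ l, g l = (i, (g j).2) := fun i => by
    simp [B, J, Prod.ext_iff, and_comm, h]
  have cardA : A.card = J.card := Finset.card_image_of_injOn fun a ha b hb hab =>
    hf.injective hx (Prod.ext hab (by simp_all [J]))
  have cardB : B.card = J.card := Finset.card_image_of_injOn fun a ha b hb hab =>
    hg.injective hx' (Prod.ext hab (by simp_all [J]))
  have upA : IsUpperSet (A : Set (Fin n)) := fun a b hab ha => by
    obtain ⟨l, hl⟩ := (memA a).1 ha
    exact (memA b).2 (hf.exists_of_le hx hl hab)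
  have upB : IsUpperSet (B : Set (Fin n)) := fun a b hab ha => by
    obtain ⟨l, hl⟩ := (memB a).1 ha
    exact (memB b).2 (hg.exists_of_le hx' hl hab)
  have hAB : A = B := by
    rcases upA.total upB with hs | hs
    · exact Finset.eq_of_subset_of_card_le (Finset.coe_subset.1 hs) (by rw [cardA, cardB])
    · exact (Finset.eq_of_subset_of_card_le (Finset.coe_subset.1 hs) (by rw [cardA, cardB])).symm
  exact (memA (g j).1).1 (hAB ▸ (memB _).2 ⟨j, rfl⟩)

theorem isInternalSwap_iff [DecidableEq M] (hf : Locates f x) (hg : Locates g x')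
    (hx : Feasible x) : IsInternalSwap x x' ↔
      ∃ j j', j ≠ j' ∧ (f j).2 = (f j').2 ∧ g j = f j' ∧ g j' = f j ∧
        ∀ l, l ≠ j → l ≠ j' → g l = f l := by
  constructor
  · rintro ⟨i, i', j, j', m, hi, hj, h, h', e⟩
    rw [hf] at h h'
    have eg : ∀ a b c, g b = (a, c) ↔ _ := fun a b c => by rw [← hg, e]
    refine ⟨j, j', hj, by rw [h, h'], ?_, ?_, fun l hl hl' => ?_⟩
    · rw [h', eg]; simp [hi.symm, hj]
    · rw [h, eg]; simp [hi, hj.symm]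
    · rw [← Prod.mk.eta (p := f l), eg]; simp [hl, hl', hf _ _ _]
  · rintro ⟨j, j', hj, hm, h, h', hl⟩
    refine ⟨(f j).1, (f j').1, j, j', (f j).2, fun hs => hj (hf.injective hx (Prod.ext hs hm)), hj,
      (hf _ _ _).2 rfl, (hf _ _ _).2 (by rw [hm]), ?_⟩
    have hne : (f j).1 ≠ (f j').1 := fun hs => hj (hf.injective hx (Prod.ext hs hm))
    funext a b c
    rw [Bool.eq_iff_iff, hg]
    by_cases hb : b = j
    · subst hb
      simp only [h, Prod.mk.injEq, hj]
      grind [hf a b c]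
    · by_cases hb' : b = j'
      · subst hb'
        simp only [h', Prod.mk.injEq, hb]
        grind [hf a b c]
      · simp [hb, hb', hl b hb hb', hf _ _ _]

theorem isStartShift_iff [DecidableEq M] (hf : Locates f x) (hg : Locates g x')
    (hx : Feasible x) (hx' : Feasible x') : IsStartShift x x' ↔
      ∃ j, (f j).2 ≠ (g j).2 ∧ ∀ l, l ≠ j → g l = f l := by
  constructor
  · rintro ⟨m, m', i, i', j, hm, h, -, -, -, e⟩
    rw [hf] at h
    have eg : ∀ a b c, g b = (a, c) ↔ _ := fun a b c => by rw [← hg, e]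
    have hgj : g j = (i', m') := by rw [eg]; simp [hm.symm]
    refine ⟨j, by rwa [h, hgj], fun l hl => ?_⟩
    rw [← Prod.mk.eta (p := f l), eg]; simp [hl, hf _ _ _]
  · rintro ⟨j, hm, hl⟩
    refine ⟨(f j).2, (g j).2, (f j).1, (g j).1, j, hm, (hf _ _ _).2 rfl, fun i l h => ?_,
      fun l => ?_, fun i hi => ?_, ?_⟩
    · by_contra! hlt
      rw [hf] at h
      have hlj : l ≠ j := by rintro rfl; exact hlt.ne' (congrArg Prod.fst h)
      obtain ⟨k, hk⟩ := hg.exists_of_le hx' ((hl l hlj).trans h) hlt.le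
      have hkj : k ≠ j := by rintro rfl; simp [hk] at hm
      exact hkj (hf.injective hx ((hl k hkj).symm.trans hk))
    · rw [Bool.eq_false_iff, Ne, hf]
      intro h
      have hlj : l ≠ j := by rintro rfl; simp [h] at hm
      exact hlj (hg.injective hx' ((hl l hlj).trans h))
    · obtain ⟨k, hk⟩ := hg.exists_of_le hx' (Prod.mk.eta (p := g j)).symm hi.le
      have hkj : k ≠ j := by rintro rfl; exact hi.ne (congrArg Prod.fst hk)
      exact ⟨k, (hf _ _ _).2 ((hl k hkj).symm.trans hk)⟩
    · funext a b c
      rw [Bool.eq_iff_iff, hg]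
      by_cases hb : b = j
      · subst hb
        simp only [Prod.mk.injEq]
        grind [hf a b c]
      · simp [hb, hl b hb, hf _ _ _]

end Locates

/-- The graphs of two functions differ in two points for every argument at which they differ. -/
theorem card_graph_ne {ι α : Type*} [Fintype ι] [Fintype α] [DecidableEq ι] [DecidableEq α]
    (f g : ι → α) :
    (Finset.univ.filter fun p : ι × α => ¬(f p.1 = p.2 ↔ g p.1 = p.2)).card =
      2 * (Finset.univ.filter fun j => f j ≠ g j).card := by
  have inj : ∀ h : ι → α, Function.Injective fun j => (j, h j) := fun h a b e => (Prod.ext_iff.1 e).1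
  have hU : (Finset.univ.filter fun p : ι × α => ¬(f p.1 = p.2 ↔ g p.1 = p.2)) =
      (Finset.univ.filter fun j => f j ≠ g j).image (fun j => (j, f j)) ∪
        (Finset.univ.filter fun j => f j ≠ g j).image (fun j => (j, g j)) := by
    ext ⟨j, a⟩
    simp only [Finset.mem_filter, Finset.mem_univ, true_and, Finset.mem_union, Finset.mem_image,
      Prod.mk.injEq, existsAndEq]
    grind
  rw [hU, Finset.card_union_of_disjoint, Finset.card_image_of_injective _ (inj f),
    Finset.card_image_of_injective _ (inj g), two_mul]
  rw [Finset.disjoint_left]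
  rintro ⟨j, a⟩
  simp only [Finset.mem_filter, Finset.mem_univ, true_and, Finset.mem_image, Prod.mk.injEq]
  grind

namespace Locates

variable {n : ℕ} {M : Type*} [Fintype M] [DecidableEq M] {f g : Fin n → Fin n × M}
  {x x' : Fin n → Fin n → M → Bool}

theorem xDist_eq (hf : Locates f x) (hg : Locates g x') :
    xDist x x' = 2 * (Finset.univ.filter fun j => f j ≠ g j).card := by
  rw [← card_graph_ne]
  refine Finset.card_bij' (fun t _ => (t.2.1, t.1, t.2.2)) (fun p _ => (p.2.1, p.1, p.2.2))
    ?_ ?_ (fun _ _ => rfl) (fun _ _ => rfl) <;>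
  · intro t
    simp only [Finset.mem_filter, Finset.mem_univ, true_and, Ne, Bool.eq_iff_iff, hf _ _ _,
      hg _ _ _]
    exact id

theorem yDist_eq (hf : Locates f x) (hg : Locates g x') :
    yDist x x' = 2 * (Finset.univ.filter fun j => (f j).2 ≠ (g j).2).card := by
  rw [← card_graph_ne (fun j => (f j).2)]
  unfold yDist
  congr 1
  ext t
  simp only [Finset.mem_filter, Finset.mem_univ, true_and, Ne, Bool.eq_iff_iff, hf.yOf_iff,
    hg.yOf_iff]

end Locates

/-- **Proposition 1: the 4-OPT neighbourhood.** For feasible assignments `x̄` and `x'`,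
the combined distance between `x'` and `x̄` is at most 4 iff `x' = x̄`, or `x'` is
obtained from `x̄` by an internal swap, or by a starting-job shift. -/
theorem stmt1 {n : ℕ} {M : Type*} [Fintype M] [DecidableEq M] [Nonempty M]
    (hn : 1 ≤ n) (xb x' : Fin n → Fin n → M → Bool)
    (hxb : Feasible xb) (hx' : Feasible x') :
    combDist x' xb ≤ 4 ↔
      x' = xb ∨ IsInternalSwap xb x' ∨ IsStartShift xb x' := by
  obtain ⟨f, hf⟩ := hxb.exists_locates
  obtain ⟨g, hg⟩ := hx'.exists_locates
  rw [hf.isInternalSwap_iff hg hxb, hf.isStartShift_iff hg hxb hx', combDist, hg.xDist_eq hf,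
    hg.yDist_eq hf]
  set S := Finset.univ.filter fun j => g j ≠ f j with hS
  set T := Finset.univ.filter fun j => (g j).2 ≠ (f j).2 with hT
  have memS : ∀ j, j ∈ S ↔ g j ≠ f j := by simp [hS]
  have memT : ∀ j, j ∈ T ↔ (g j).2 ≠ (f j).2 := by simp [hT]
  have hTS : T ⊆ S := fun j hj => (memS j).2 fun h => (memT j).1 hj (by rw [h])
  constructor
  · intro hle
    have hcard := Finset.card_le_card hTS
    rcases T.eq_empty_or_nonempty with hT0 | hT0
    · have hsnd : ∀ j, (f j).2 = (g j).2 := fun j => by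
        by_contra h
        simpa [hT0] using (memT j).2 (Ne.symm h)
      have hmove : ∀ j ∈ S, ∃ k ∈ S, k ≠ j ∧ g j = f k := fun j hj => by
        obtain ⟨k, hk⟩ := hf.exists_eq_of_snd_eq hg hxb hx' hsnd j
        have hkj : k ≠ j := by rintro rfl; exact (memS k).1 hj hk.symm
        exact ⟨k, (memS k).2 fun h => hkj (hg.injective hx' (h.trans hk)), hkj, hk.symm⟩
      rcases S.eq_empty_or_nonempty with hS0 | ⟨j, hj⟩
      · refine Or.inl (hg.eq_of_eq ?_)
        have hgf : g = f := funext fun j => by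
          by_contra h
          simpa [hS0] using (memS j).2 h
        rwa [hgf]
      · obtain ⟨k, hk, hkj, hgj⟩ := hmove j hj
        have hSjk : S = {j, k} := (Finset.eq_of_subset_of_card_le
          (by simp [Finset.insert_subset_iff, hj, hk])
          (by rw [Finset.card_pair hkj.symm]; omega)).symm
        obtain ⟨l, hl, hlk, hgk⟩ := hmove k hk
        have hlj : l = j := by simpa [hSjk, hlk] using hl
        subst hlj
        refine Or.inr (Or.inl ⟨l, k, hkj.symm, by rw [hsnd l, hgj], hgj, hgk, fun a ha ha' => ?_⟩)
        by_contra h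
        simpa [hSjk, ha, ha'] using (memS a).2 h
    · have hT1 := hT0.card_pos
      obtain ⟨j, hSj⟩ := Finset.card_eq_one.1 (show S.card = 1 by omega)
      obtain ⟨k, hk⟩ := hT0
      have hkj : k = j := by simpa [hSj] using hTS hk
      subst hkj
      refine Or.inr (Or.inr ⟨k, ((memT k).1 hk).symm, fun l hl => ?_⟩)
      by_contra h
      simpa [hSj, hl] using (memS l).2 h
  · rintro (rfl | ⟨j, k, -, hm, hj, hk, hl⟩ | ⟨j, -, hl⟩)
    · have hS0 : S = ∅ := Finset.eq_empty_of_forall_notMem fun j hj =>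
        (memS j).1 hj ((hg _ _ _).1 ((hf _ _ _).2 rfl))
      have hT0 : T = ∅ := Finset.subset_empty.1 (hS0 ▸ hTS)
      simp [hS0, hT0]
    · have hS2 : S ⊆ {j, k} := fun l h => by
        by_contra hn
        simp only [Finset.mem_insert, Finset.mem_singleton, not_or] at hn
        exact (memS l).1 h (hl l hn.1 hn.2)
      have hT0 : T = ∅ := Finset.eq_empty_of_forall_notMem fun l h => by
        have hl' := hS2 (hTS h)
        simp only [Finset.mem_insert, Finset.mem_singleton] at hl'
        rcases hl' with rfl | rfl
        · exact (memT l).1 h (by rw [hj, hm])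
        · exact (memT l).1 h (by rw [hk, hm])
      have := (Finset.card_le_card hS2).trans Finset.card_le_two
      simp only [hT0, Finset.card_empty]
      omega
    · have hS1 : S ⊆ {j} := fun l h => by
        by_contra hn
        exact (memS l).1 h (hl l (by simpa using hn))
      have := Finset.card_le_card hS1
      have := Finset.card_le_card hTS
      simp only [Finset.card_singleton] at *
      omega
end

section
/- If x' is obtained from a feasible assignment x̄ by a starting-job shift, then x' is feasible, the x-distance between x' and x̄ is exactly 2, and the y-distance between x' and x̄ is exactly 2; hence the combined distance between x' and x̄ is exactly 4. -/
section Relocation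

variable {n : ℕ} {M : Type*}

/-- `x'` arises from `x` by relocating job `j` from slot `i` of machine `m` to slot `i'` of
machine `m'`. -/
def IsRelocation (x x' : Fin n → Fin n → M → Bool) (j i i' : Fin n) (m m' : M) : Prop :=
  (∀ a b c, b ≠ j → x' a b c = x a b c) ∧
  (∀ a c, x a j c = true ↔ a = i ∧ c = m) ∧ ∀ a c, x' a j c = true ↔ a = i' ∧ c = m'

theorem Feasible.eq_of_eq_true {x : Fin n → Fin n → M → Bool} (hx : Feasible x)
    {a i j : Fin n} {c m : M} (h : x a j c = true) (h' : x i j m = true) : a = i ∧ c = m :=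
  Prod.ext_iff.1 ((hx.1 j).unique (y₁ := (a, c)) (y₂ := (i, m)) h h')

theorem IsRelocation.xDist_eq_two [Fintype M] {x x' : Fin n → Fin n → M → Bool}
    {j i i' : Fin n} {m m' : M} (h : IsRelocation x x' j i i' m m') (hm : m ≠ m') :
    xDist x' x = 2 := by
  classical
  obtain ⟨hne, hx, hx'⟩ := h
  have hset : (Finset.univ : Finset (Fin n × Fin n × M)).filter
      (fun t => x' t.1 t.2.1 t.2.2 ≠ x t.1 t.2.1 t.2.2) = {(i, j, m), (i', j, m')} := by
    ext ⟨a, b, c⟩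
    have := hx a c
    have := hx' a c
    by_cases hb : b = j
    · subst hb
      simp only [Finset.mem_filter, Finset.mem_univ, true_and, Finset.mem_insert,
        Finset.mem_singleton, Prod.mk.injEq, ne_eq]
      grind
    · simp [hne a b c hb, hb]
  rw [xDist, hset, Finset.card_pair (by simp [hm])]

theorem IsRelocation.yDist_eq_two [Fintype M] {x x' : Fin n → Fin n → M → Bool}
    {j i i' : Fin n} {m m' : M} (h : IsRelocation x x' j i i' m m') (hm : m ≠ m') :
    yDist x' x = 2 := by
  classical
  obtain ⟨hne, hx, hx'⟩ := h
  have hset : (Finset.univ : Finset (Fin n × M)).filter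
      (fun t => yOf x' t.1 t.2 ≠ yOf x t.1 t.2) = {(j, m), (j, m')} := by
    ext ⟨b, c⟩
    by_cases hb : b = j
    · subst hb
      simp only [yOf, hx, hx', Finset.mem_filter, Finset.mem_univ, true_and, Finset.mem_insert,
        Finset.mem_singleton, Prod.mk.injEq, ne_eq, decide_eq_decide, exists_eq_left]
      grind
    · have : ∀ a, x' a b c = x a b c := fun a => hne a b c hb
      simp [yOf, this, hb]
  rw [yDist, hset, Finset.card_pair (by simp [hm])]

theorem IsRelocation.feasible {x x' : Fin n → Fin n → M → Bool}
    {j i i' : Fin n} {m m' : M} (h : IsRelocation x x' j i i' m m') (hx : Feasible x)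
    (hmin : ∀ a b, x a b m = true → i ≤ a) (hempty : ∀ b, x i' b m' = false)
    (hlater : ∀ a, i' < a → ∃ b, x a b m' = true) (hm : m ≠ m') : Feasible x' := by
  obtain ⟨hne, hj, hj'⟩ := h
  obtain ⟨hjob, hslot, hnext⟩ := hx
  have keep : ∀ {a b c}, x a b c = true → ¬ (a = i ∧ c = m) → x' a b c = true := by
    intro a b c hab hac
    by_cases hb : b = j
    · subst hb
      exact absurd ((hj a c).1 hab) hac
    · rwa [hne a b c hb]
  refine ⟨fun b => ?_, fun a c b b' hb hb' => ?_, fun c a ha hocc => ?_⟩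
  · by_cases hb : b = j
    · subst hb
      exact ⟨(i', m'), (hj' _ _).2 ⟨rfl, rfl⟩, fun p hp => Prod.ext_iff.2 ((hj' _ _).1 hp)⟩
    · simpa only [hne _ b _ hb] using hjob b
  · grind
  · obtain ⟨b, hb⟩ := hocc
    by_cases hbj : b = j
    · subst hbj
      obtain ⟨rfl, rfl⟩ := (hj' a c).1 hb
      obtain ⟨b', hb'⟩ := hlater ⟨a.val + 1, ha⟩ (Fin.lt_def.2 (Nat.lt_succ_self _))
      exact ⟨b', keep hb' fun h => hm h.2.symm⟩
    · rw [hne a b c hbj] at hb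
      obtain ⟨b', hb'⟩ := hnext c a ha ⟨b, hb⟩
      refine ⟨b', keep hb' ?_⟩
      rintro ⟨hai, rfl⟩
      have hle := hmin a b hb
      rw [← hai, Fin.le_def] at hle
      exact absurd hle (Nat.not_succ_le_self _)

theorem IsStartShift.exists_isRelocation [DecidableEq M] {x x' : Fin n → Fin n → M → Bool}
    (h : IsStartShift x x') (hx : Feasible x) :
    ∃ (j i i' : Fin n) (m m' : M), IsRelocation x x' j i i' m m' ∧ m ≠ m' ∧
      (∀ a b, x a b m = true → i ≤ a) ∧ (∀ b, x i' b m' = false) ∧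
      ∀ a, i' < a → ∃ b, x a b m' = true := by
  obtain ⟨m, m', i, i', j, hm, hij, hmin, hempty, hlater, rfl⟩ := h
  have hj : ∀ a c, x a j c = true ↔ a = i ∧ c = m := fun a c =>
    ⟨fun h => hx.eq_of_eq_true h hij, by rintro ⟨rfl, rfl⟩; exact hij⟩
  refine ⟨j, i, i', m, m', ⟨fun a b c hb => by simp [hb], hj, fun a c => ?_⟩,
    hm, hmin, hempty, hlater⟩
  have := hj a c
  simp only [Prod.mk.injEq, true_and]
  grind

end Relocation

/-- **Starting-job shifts are feasible, have x-distance exactly 2 and y-distance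
exactly 2** (hence combined distance exactly 4). -/
theorem stmt5 {n : ℕ} {M : Type*} [Fintype M] [DecidableEq M] [Nonempty M]
    (hn : 1 ≤ n) (xb x' : Fin n → Fin n → M → Bool)
    (hxb : Feasible xb) (hshift : IsStartShift xb x') :
    Feasible x' ∧ xDist x' xb = 2 ∧ yDist x' xb = 2 ∧ combDist x' xb = 4 := by
  obtain ⟨j, i, i', m, m', hrel, hm, hmin, hempty, hlater⟩ := hshift.exists_isRelocation hxb
  have hxd := hrel.xDist_eq_two hm
  have hyd := hrel.yDist_eq_two hm
  exact ⟨hrel.feasible hxb hmin hempty hlater hm, hxd, hyd, by rw [combDist, hxd, hyd]⟩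
end

section
/- If x' is obtained from a feasible assignment x̄ by an internal h-swap for some h ≥ 2, then x' is feasible, y(x') = y(x̄), and the x-distance between x' and x̄ is exactly 2h. -/
/-- The second assignment arises from the first by moving each job `jb l` to the slot `sl (r l)`
of machine `m` and leaving all other jobs in place. -/
def IsSlotRotation {n : ℕ} {M ι : Type*} (m : M) (jb sl : ι → Fin n) (r : ι → ι)
    (xb x' : Fin n → Fin n → M → Bool) : Prop :=
  ∀ a b c, x' a b c = true ↔
    (c = m ∧ ∃ l, a = sl (r l) ∧ b = jb l) ∨ (xb a b c = true ∧ ∀ l, b ≠ jb l)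

section SlotRotation

variable {n : ℕ} {M ι : Type*} {m : M} {jb sl : ι → Fin n} {r : ι → ι}
  {xb x' : Fin n → Fin n → M → Bool}

theorem Feasible.position_unique (hxb : Feasible xb) {a a' b : Fin n} {c c' : M}
    (h₁ : xb a b c = true) (h₂ : xb a' b c' = true) : a = a' ∧ c = c' := by
  have := (hxb.1 b).unique (y₁ := (a, c)) (y₂ := (a', c')) h₁ h₂
  simpa using this

theorem IsSlotRotation.occupied_iff (hx : IsSlotRotation m jb sl r xb x')
    (hxb : Feasible xb) (hr : Function.Surjective r) (hocc : ∀ l, xb (sl l) (jb l) m = true)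
    (a : Fin n) (c : M) : (∃ j, x' a j c = true) ↔ ∃ j, xb a j c = true := by
  constructor
  · rintro ⟨j, hj⟩
    rcases (hx a j c).1 hj with ⟨rfl, l, rfl, rfl⟩ | ⟨hj, -⟩
    · exact ⟨_, hocc (r l)⟩
    · exact ⟨j, hj⟩
  · rintro ⟨j, hj⟩
    by_cases hl : ∃ l, j = jb l
    · obtain ⟨l, rfl⟩ := hl
      obtain ⟨rfl, rfl⟩ := hxb.position_unique hj (hocc l)
      obtain ⟨k, rfl⟩ := hr l
      exact ⟨jb k, (hx _ _ _).2 (.inl ⟨rfl, k, rfl, rfl⟩)⟩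
    · exact ⟨j, (hx _ _ _).2 (.inr ⟨hj, not_exists.1 hl⟩)⟩

theorem IsSlotRotation.feasible (hx : IsSlotRotation m jb sl r xb x')
    (hxb : Feasible xb) (hr : Function.Bijective r) (hjb : Function.Injective jb)
    (hsl : Function.Injective sl) (hocc : ∀ l, xb (sl l) (jb l) m = true) : Feasible x' := by
  refine ⟨fun j => ?_, fun i c j j' hj hj' => ?_, fun c i hi hj => ?_⟩
  · by_cases hl : ∃ l, j = jb l
    · obtain ⟨l, rfl⟩ := hl
      refine ⟨(sl (r l), m), (hx _ _ _).2 (.inl ⟨rfl, l, rfl, rfl⟩), ?_⟩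
      rintro ⟨a, c⟩ hac
      rcases (hx a _ c).1 hac with ⟨rfl, k, rfl, hk⟩ | ⟨-, hk⟩
      · rw [hjb hk]
      · exact absurd rfl (hk l)
    · obtain ⟨⟨a, c⟩, hac, -⟩ := hxb.1 j
      refine ⟨(a, c), (hx _ _ _).2 (.inr ⟨hac, not_exists.1 hl⟩), ?_⟩
      rintro ⟨a', c'⟩ hac'
      rcases (hx a' _ c').1 hac' with ⟨-, k, -, hk⟩ | ⟨hk, -⟩
      · exact absurd ⟨k, hk⟩ hl
      · obtain ⟨rfl, rfl⟩ := hxb.position_unique hk hac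
        rfl
  · rcases (hx i j c).1 hj with ⟨rfl, l, rfl, rfl⟩ | ⟨hj, hl⟩ <;>
      rcases (hx _ j' _).1 hj' with ⟨hc, k, hk, rfl⟩ | ⟨hj', hk⟩
    · rw [hr.1 (hsl hk)]
    · exact absurd (hxb.2.1 _ _ _ _ hj' (hocc (r l))) (hk _)
    · subst hc hk
      exact absurd (hxb.2.1 _ _ _ _ hj (hocc (r k))) (hl _)
    · exact hxb.2.1 _ _ _ _ hj hj'
  · rw [hx.occupied_iff hxb hr.2 hocc] at hj ⊢
    exact hxb.2.2 c i hi hj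

theorem IsSlotRotation.yOf_eq (hx : IsSlotRotation m jb sl r xb x')
    (hxb : Feasible xb) (hocc : ∀ l, xb (sl l) (jb l) m = true) : yOf x' = yOf xb := by
  funext j c
  refine decide_eq_decide.2 ⟨?_, ?_⟩
  · rintro ⟨i, hi⟩
    rcases (hx i j c).1 hi with ⟨rfl, l, rfl, rfl⟩ | ⟨hi, -⟩
    · exact ⟨_, hocc l⟩
    · exact ⟨i, hi⟩
  · rintro ⟨i, hi⟩
    by_cases hl : ∃ l, j = jb l
    · obtain ⟨l, rfl⟩ := hl
      obtain ⟨rfl, rfl⟩ := hxb.position_unique hi (hocc l)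
      exact ⟨sl (r l), (hx _ _ _).2 (.inl ⟨rfl, l, rfl, rfl⟩)⟩
    · exact ⟨i, (hx _ _ _).2 (.inr ⟨hi, not_exists.1 hl⟩)⟩

theorem IsSlotRotation.ne_iff (hx : IsSlotRotation m jb sl r xb x')
    (hxb : Feasible xb) (hr : ∀ l, r l ≠ l) (hjb : Function.Injective jb)
    (hsl : Function.Injective sl) (hocc : ∀ l, xb (sl l) (jb l) m = true)
    (a b : Fin n) (c : M) : x' a b c ≠ xb a b c ↔
      (∃ l, (sl l, jb l, m) = (a, b, c)) ∨ ∃ l, (sl (r l), jb l, m) = (a, b, c) := by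
  rw [Ne, Bool.eq_iff_iff, hx]
  by_cases hl : ∃ l, b = jb l
  · obtain ⟨l, rfl⟩ := hl
    have hold : xb a (jb l) c = true ↔ sl l = a ∧ m = c :=
      ⟨fun h => hxb.position_unique (hocc l) h, by rintro ⟨rfl, rfl⟩; exact hocc l⟩
    have hne : sl (r l) ≠ sl l := hsl.ne (hr l)
    simp only [hold, Prod.mk.injEq, hjb.eq_iff]
    grind
  · grind

theorem IsSlotRotation.xDist_eq [Fintype M] [Fintype ι]
    (hx : IsSlotRotation m jb sl r xb x')
    (hxb : Feasible xb) (hr : ∀ l, r l ≠ l) (hjb : Function.Injective jb)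
    (hsl : Function.Injective sl) (hocc : ∀ l, xb (sl l) (jb l) m = true) :
    xDist x' xb = 2 * Fintype.card ι := by
  classical
  have hset : (Finset.univ : Finset (Fin n × Fin n × M)).filter
      (fun t => x' t.1 t.2.1 t.2.2 ≠ xb t.1 t.2.1 t.2.2) =
      Finset.univ.image (fun l => (sl l, jb l, m)) ∪
        Finset.univ.image (fun l => (sl (r l), jb l, m)) := by
    ext ⟨a, b, c⟩
    rw [Finset.mem_filter_univ, hx.ne_iff hxb hr hjb hsl hocc]
    simp only [Finset.mem_union, Finset.mem_image, Finset.mem_univ, true_and]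
  have hinj (s : ι → Fin n) : Function.Injective fun l => (s l, jb l, m) := fun l k hlk =>
    hjb (congrArg (fun t => t.2.1) hlk)
  rw [xDist, hset, Finset.card_union_of_disjoint, Finset.card_image_of_injective _ (hinj _),
    Finset.card_image_of_injective _ (hinj fun l => sl (r l)), Finset.card_univ, two_mul]
  simp only [Finset.disjoint_left, Finset.mem_image, Finset.mem_univ, true_and]
  rintro _ ⟨l, rfl⟩ ⟨k, hk⟩
  simp only [Prod.mk.injEq] at hk
  obtain rfl := hjb hk.2.1
  exact hr k (hsl hk.1)

end SlotRotation

theorem IsInternalHSwap.exists_isSlotRotation {n : ℕ} {M : Type*} [DecidableEq M] {h : ℕ}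
    {xb x' : Fin n → Fin n → M → Bool} (hxb : Feasible xb) (hswap : IsInternalHSwap h xb x') :
    ∃ (m : M) (jb sl : Fin h → Fin n) (r : Fin h → Fin h), Function.Injective jb ∧
      Function.Injective sl ∧ (∀ l, xb (sl l) (jb l) m = true) ∧ Function.Bijective r ∧
      (∀ l, r l ≠ l) ∧ IsSlotRotation m jb sl r xb x' := by
  obtain ⟨hh, m, jb, sl, hjb, hsl, hocc, rfl⟩ := hswap
  set r : Fin h → Fin h := fun l => ⟨(l.val + 1) % h, Nat.mod_lt _ (by omega)⟩ with hr
  have hval (l : Fin h) : (r l).val = if l.val + 1 = h then 0 else l.val + 1 := by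
    simp only [hr]
    split_ifs with hl
    · rw [hl, Nat.mod_self]
    · exact Nat.mod_eq_of_lt (by omega)
  have hne (l : Fin h) : r l ≠ l := fun hl => by
    have := hval l
    rw [hl] at this
    split_ifs at this <;> omega
  have hinj : Function.Injective r := fun l k hlk => by
    have h₁ := hval l
    have h₂ := hval k
    rw [hlk] at h₁
    ext
    split_ifs at h₁ h₂ <;> omega
  refine ⟨m, jb, sl, r, hjb, hsl, hocc, Finite.injective_iff_bijective.1 hinj, hne, ?_⟩
  intro a b c
  change (if c = m ∧ ∃ l, a = sl l ∧ b = jb l then false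
    else if c = m ∧ ∃ l, a = sl (r l) ∧ b = jb l then true else xb a b c) = true ↔ _
  have hold (l : Fin h) (hb : b = jb l) (hx : xb a b c = true) : a = sl l ∧ c = m := by
    subst hb
    exact hxb.position_unique hx (hocc l)
  split_ifs with h₁ h₂
  · obtain ⟨rfl, l, rfl, rfl⟩ := h₁
    simp only [false_iff]
    rintro (⟨-, k, hk, hkl⟩ | ⟨-, hk⟩)
    · obtain rfl := hjb hkl
      exact hne l (hsl hk).symm
    · exact hk l rfl
  · exact iff_of_true rfl (.inl h₂)
  · refine ⟨fun hx => .inr ⟨hx, fun l hb => h₁ ?_⟩, fun hx => (hx.resolve_left h₂).1⟩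
    exact ⟨(hold l hb hx).2, l, (hold l hb hx).1, hb⟩

/-- **Internal `h`-swaps are feasible, preserve machine assignments, and have
x-distance exactly `2 * h`.** -/
theorem stmt6 {n : ℕ} {M : Type*} [Fintype M] [DecidableEq M] [Nonempty M]
    (hn : 1 ≤ n) (h : ℕ) (hh : 2 ≤ h) (xb x' : Fin n → Fin n → M → Bool)
    (hxb : Feasible xb) (hswap : IsInternalHSwap h xb x') :
    Feasible x' ∧ yOf x' = yOf xb ∧ xDist x' xb = 2 * h := by
  obtain ⟨m, jb, sl, r, hjb, hsl, hocc, hr, hne, hx⟩ := hswap.exists_isSlotRotation hxb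
  exact ⟨hx.feasible hxb hr hjb hsl hocc, hx.yOf_eq hxb hocc,
    by simpa using hx.xDist_eq hxb hne hjb hsl hocc⟩
end

section
/- If x' is obtained from a feasible assignment x̄ by an external swap, then x' is feasible, the x-distance between x' and x̄ is exactly 4, and the y-distance between x' and x̄ is exactly 4; hence the combined distance between x' and x̄ is exactly 8. -/
section ExternalSwap

variable {n : ℕ} {M : Type*} {x : Fin n → Fin n → M → Bool}

/-- The position of a job in a feasible assignment is unique. -/
theorem Feasible.position_unique_s7 (hx : Feasible x) {a b j : Fin n} {c d : M}
    (h : x a j c = true) (h' : x b j d = true) : a = b ∧ c = d :=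
  Prod.ext_iff.1 ((hx.1 j).unique (y₁ := (a, c)) (y₂ := (b, d)) h h')

/-- Relabelling the jobs by a permutation preserves feasibility. -/
theorem Feasible.comp_perm (hx : Feasible x) (σ : Equiv.Perm (Fin n)) :
    Feasible fun a b c => x a (σ b) c := by
  refine ⟨fun j => hx.1 (σ j), fun i m j j' h h' => σ.injective (hx.2.1 i m _ _ h h'), ?_⟩
  rintro m i hi ⟨j, hj⟩
  obtain ⟨k, hk⟩ := hx.2.2 m i hi ⟨_, hj⟩
  exact ⟨σ.symm k, by simpa using hk⟩

theorem Feasible.eq_true_iff (hx : Feasible x) {i j : Fin n} {m : M} (h : x i j m = true)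
    (a : Fin n) (c : M) : x a j c = true ↔ a = i ∧ c = m :=
  ⟨fun h' => hx.position_unique_s7 h' h, by rintro ⟨rfl, rfl⟩; exact h⟩

theorem Feasible.yOf_eq_true_iff (hx : Feasible x) {i j : Fin n} {m : M}
    (h : x i j m = true) (c : M) : yOf x j c = true ↔ c = m := by
  simp [yOf, hx.eq_true_iff h]

/-- Exchanging the positions of two jobs is the same as exchanging their names. -/
theorem Feasible.externalSwap_eq [DecidableEq M] (hx : Feasible x) {i i' j j' : Fin n}
    {m m' : M} (hj : j ≠ j') (hm : m ≠ m') (h : x i j m = true) (h' : x i' j' m' = true) :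
    (fun a b c =>
      if (a, b, c) = (i, j, m) then false
      else if (a, b, c) = (i', j', m') then false
      else if (a, b, c) = (i', j, m') then true
      else if (a, b, c) = (i, j', m) then true
      else x a b c) = fun a b c => x a (Equiv.swap j j' b) c := by
  funext a b c
  have e := hx.eq_true_iff h a c
  have e' := hx.eq_true_iff h' a c
  rw [Equiv.swap_apply_def]
  simp only [Prod.mk.injEq]
  grind

theorem Feasible.xDist_swap [Fintype M] (hx : Feasible x) {i i' j j' : Fin n} {m m' : M}
    (hj : j ≠ j') (hm : m ≠ m') (h : x i j m = true) (h' : x i' j' m' = true) :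
    xDist (fun a b c => x a (Equiv.swap j j' b) c) x = 4 := by
  classical
  have key : (Finset.univ : Finset (Fin n × Fin n × M)).filter
      (fun t => x t.1 (Equiv.swap j j' t.2.1) t.2.2 ≠ x t.1 t.2.1 t.2.2) =
      {(i, j, m), (i', j', m'), (i', j, m'), (i, j', m)} := by
    ext ⟨a, b, c⟩
    have e := hx.eq_true_iff h a c
    have e' := hx.eq_true_iff h' a c
    rw [Finset.mem_filter, Equiv.swap_apply_def]
    simp only [Finset.mem_univ, true_and, Finset.mem_insert, Finset.mem_singleton,
      Prod.mk.injEq]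
    grind
  rw [xDist, key]
  simp [hj, hj.symm, hm, hm.symm]

theorem Feasible.yDist_swap [Fintype M] (hx : Feasible x) {i i' j j' : Fin n} {m m' : M}
    (hj : j ≠ j') (hm : m ≠ m') (h : x i j m = true) (h' : x i' j' m' = true) :
    yDist (fun a b c => x a (Equiv.swap j j' b) c) x = 4 := by
  classical
  have key : (Finset.univ : Finset (Fin n × M)).filter
      (fun t => yOf x (Equiv.swap j j' t.1) t.2 ≠ yOf x t.1 t.2) =
      {(j, m), (j', m'), (j, m'), (j', m)} := by
    ext ⟨b, c⟩
    have e := hx.yOf_eq_true_iff h c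
    have e' := hx.yOf_eq_true_iff h' c
    rw [Finset.mem_filter, Equiv.swap_apply_def]
    simp only [Finset.mem_univ, true_and, Finset.mem_insert, Finset.mem_singleton,
      Prod.mk.injEq]
    grind
  change (Finset.univ.filter
    (fun t : Fin n × M => yOf x (Equiv.swap j j' t.1) t.2 ≠ yOf x t.1 t.2)).card = 4
  rw [key]
  simp [hj, hj.symm, hm, hm.symm]

end ExternalSwap

/-- **External swaps are feasible, have x-distance exactly 4 and y-distance exactly 4**
(hence combined distance exactly 8). -/
theorem stmt7 {n : ℕ} {M : Type*} [Fintype M] [DecidableEq M] [Nonempty M]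
    (hn : 1 ≤ n) (xb x' : Fin n → Fin n → M → Bool)
    (hxb : Feasible xb) (hswap : IsExternalSwap xb x') :
    Feasible x' ∧ xDist x' xb = 4 ∧ yDist x' xb = 4 ∧ combDist x' xb = 8 := by
  obtain ⟨i, i', j, j', m, m', hj, hm, h, h', rfl⟩ := hswap
  rw [hxb.externalSwap_eq hj hm h h', combDist, hxb.xDist_swap hj hm h h',
    hxb.yDist_swap hj hm h h']
  exact ⟨hxb.comp_perm _, rfl, rfl, rfl⟩
end

section
/- Let x̄ and x' be feasible assignments with y(x') = y(x̄) (every job is assigned to the same machine in both) and x' ≠ x̄. Then at least two jobs occupy a different slot in x' than in x̄; consequently the x-distance between x' and x̄ is at least 4. In particular, no feasible assignment is obtained from x̄ by moving exactly one job to a different slot of the same machine while leaving all other jobs in their slots. -/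
section Scheduling

variable {n : ℕ} {M : Type*} {x x' : Fin n → Fin n → M → Bool}

/-- A feasible assignment is described by the slot and the machine of each job. -/
theorem Feasible.exists_slot_machine (hx : Feasible x) :
    ∃ (s : Fin n → Fin n) (μ : Fin n → M),
      ∀ i j m, x i j m = true ↔ i = s j ∧ m = μ j := by
  choose p hp hu using hx.1
  refine ⟨fun j => (p j).1, fun j => (p j).2, fun i j m => ⟨fun h => ?_, ?_⟩⟩
  · have := hu j (i, m) h
    exact ⟨congrArg Prod.fst this, congrArg Prod.snd this⟩
  · rintro ⟨rfl, rfl⟩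
    exact hp j

/-- The occupied slots of a machine form an upper set. -/
theorem Feasible.isUpperSet_occupied (hx : Feasible x) (m : M) :
    IsUpperSet {i : Fin n | ∃ j, x i j m = true} := by
  rintro ⟨a, ha⟩ ⟨b, hb⟩ (hab : a ≤ b) h
  induction b, hab using Nat.le_induction with
  | base => exact h
  | succ k hk ih => exact hx.2.2 m ⟨k, by omega⟩ hb (ih (by omega))

/-- The number of occupied slots of a machine is the number of jobs assigned to it. -/
theorem Feasible.ncard_occupied (hx : Feasible x) (m : M) :
    {i : Fin n | ∃ j, x i j m = true}.ncard = {j : Fin n | yOf x j m = true}.ncard := by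
  obtain ⟨s, μ, hs⟩ := hx.exists_slot_machine
  have himage : {i : Fin n | ∃ j, x i j m = true} = s '' {j | yOf x j m = true} := by
    ext i
    simp only [yOf, hs, Set.mem_ofPred_eq, Set.mem_image, decide_eq_true_eq]
    grind
  rw [himage, Set.InjOn.ncard_image]
  intro j hj j' hj' h
  simp only [yOf, hs, Set.mem_ofPred_eq, decide_eq_true_eq] at hj hj'
  exact hx.2.1 (s j) m j j' (by grind) (by grind)

/-- Feasible assignments with equal machine indicators occupy the same slots. -/
theorem Feasible.occupied_eq (hx : Feasible x) (hx' : Feasible x') (hy : yOf x' = yOf x)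
    (m : M) : {i : Fin n | ∃ j, x i j m = true} = {i | ∃ j, x' i j m = true} := by
  have hcard := (hx.ncard_occupied m).trans ((hx'.ncard_occupied m).trans (by rw [hy])).symm
  rcases (hx.isUpperSet_occupied m).total (hx'.isUpperSet_occupied m) with h | h
  · exact Set.eq_of_subset_of_ncard_le h hcard.ge
  · exact (Set.eq_of_subset_of_ncard_le h hcard.le).symm

end Scheduling

/-- **No single job can change slot within its machine.** If the feasible assignments
`x̄ ≠ x'` give every job the same machine, then at least two jobs occupy different
slots in `x'` than in `x̄`; consequently the x-distance is at least 4. -/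
theorem stmt9 {n : ℕ} {M : Type*} [Fintype M] [DecidableEq M] [Nonempty M]
    (hn : 1 ≤ n) (xb x' : Fin n → Fin n → M → Bool)
    (hxb : Feasible xb) (hx' : Feasible x')
    (hy : yOf x' = yOf xb) (hne : x' ≠ xb) :
    (∃ j₁ j₂ : Fin n, j₁ ≠ j₂
        ∧ (∃ (i : Fin n) (m : M), x' i j₁ m ≠ xb i j₁ m)
        ∧ (∃ (i : Fin n) (m : M), x' i j₂ m ≠ xb i j₂ m))
    ∧ 4 ≤ xDist x' xb := by
  obtain ⟨s, μ, hs⟩ := hxb.exists_slot_machine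
  obtain ⟨s', μ', hs'⟩ := hx'.exists_slot_machine
  have hμ : μ' = μ := by
    funext j
    have h := congrFun (congrFun hy j) (μ' j)
    simpa [yOf, hs, hs'] using h
  subst hμ
  obtain ⟨j, hj⟩ : ∃ j, s j ≠ s' j := by
    by_contra! h
    refine hne ?_
    funext i j m
    rw [Bool.eq_iff_iff, hs, hs', h]
  obtain ⟨k, hk⟩ : ∃ k, x' (s j) k (μ' j) = true :=
    (hxb.occupied_eq hx' hy (μ' j)).subset ⟨j, by simp [hs]⟩
  obtain ⟨hk, hm⟩ := (hs' _ _ _).1 hk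
  have hkj : k ≠ j := by
    rintro rfl
    exact hj hk
  have hsk : s k ≠ s' k := fun h => hkj
    (hxb.2.1 (s j) (μ' j) k j ((hs _ _ _).2 ⟨hk.trans h.symm, hm⟩) ((hs _ _ _).2 ⟨rfl, rfl⟩))
  have hold : ∀ l, s l ≠ s' l → x' (s l) l (μ' l) ≠ xb (s l) l (μ' l) := fun l hl h => by
    rw [Bool.eq_iff_iff, hs, hs'] at h
    exact hl (h.2 ⟨rfl, rfl⟩).1
  have hnew : ∀ l, s l ≠ s' l → x' (s' l) l (μ' l) ≠ xb (s' l) l (μ' l) := fun l hl h => by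
    rw [Bool.eq_iff_iff, hs, hs'] at h
    exact hl (h.1 ⟨rfl, rfl⟩).1.symm
  refine ⟨⟨j, k, hkj.symm, ⟨_, _, hold j hj⟩, ⟨_, _, hold k hsk⟩⟩, ?_⟩
  have hcard : ({(s j, j, μ' j), (s' j, j, μ' j), (s k, k, μ' k), (s' k, k, μ' k)} :
      Finset (Fin n × Fin n × M)).card = 4 := by
    simp [Finset.card_insert_of_notMem, hj, hsk, hkj.symm]
  rw [xDist, ← hcard]
  refine Finset.card_le_card fun t ht => ?_
  simp only [Finset.mem_insert, Finset.mem_singleton] at ht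
  rw [Finset.mem_filter]
  refine ⟨Finset.mem_univ t, ?_⟩
  rcases ht with rfl | rfl | rfl | rfl
  exacts [hold j hj, hnew j hj, hold k hsk, hnew k hsk]
end

section
/- Let n ≥ 2, let x be a feasible assignment, let s : Fin n → Fin n → M → ℝ be a family of setup times, and for each job k and machine m let s⁻ k m = min_{l ≠ k} s k l m. Then for every machine m, every slot i ≥ 1 and every job k with x (i−1) k m = true, there exists a job j ≠ k with x i j m = true and s k j m ≥ s⁻ k m. Consequently, in every feasible solution in which the setup value S_{i m} of an occupied slot i ≥ 1 of machine m equals s k j m, where k is the job occupying slot i−1 and j the job occupying slot i (and S_{i m} = 0 if slot i−1 is empty), the valid inequalities S_{i m} ≥ Σ_j s⁻ j m · x_{i−1, j, m} hold for all slots i ≥ 1 and machines m. -/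
/-- **Validity of the setup-time inequalities (8).** Let `x` be a feasible assignment,
`s k j m` the setup time of job `j` succeeding job `k` on machine `m`, and
`s⁻ k m = min_{l ≠ k} s k l m`. Then whenever job `k` occupies slot `i` of machine `m`,
the next slot is occupied by some job `j ≠ k` with `s k j m ≥ s⁻ k m`; consequently any
setup values `S` consistent with `x` (equal to `s k j m` when `k, j` occupy consecutive
slots, and `0` below an empty slot) satisfy `S_{i+1,m} ≥ Σ_j s⁻ j m · x_{i j m}`. -/
theorem stmt14 {n : ℕ} {M : Type*} [Fintype M] [DecidableEq M] [Nonempty M]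
    (hn : 2 ≤ n)
    (x : Fin n → Fin n → M → Bool) (hx : Feasible x)
    (s : Fin n → Fin n → M → ℝ)
    (sminus : Fin n → M → ℝ)
    (hsm : ∀ (k : Fin n) (m : M),
      sminus k m =
        ((Finset.univ : Finset (Fin n)).filter (fun l => l ≠ k)).inf'
          (by
            have hnt : Nontrivial (Fin n) := Fin.nontrivial_iff_two_le.mpr hn
            obtain ⟨l, hl⟩ := exists_ne k
            exact ⟨l, by simp [hl]⟩)
          (fun l => s k l m)) :
    (∀ (m : M) (i : Fin n) (hi : i.val + 1 < n) (k : Fin n),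
        x i k m = true →
        ∃ j : Fin n, j ≠ k ∧ x ⟨i.val + 1, hi⟩ j m = true ∧ sminus k m ≤ s k j m)
    ∧ ∀ S : Fin n → M → ℝ,
        (∀ (m : M) (i : Fin n) (hi : i.val + 1 < n) (k j : Fin n),
          x i k m = true → x ⟨i.val + 1, hi⟩ j m = true →
          S ⟨i.val + 1, hi⟩ m = s k j m) →
        (∀ (m : M) (i : Fin n) (hi : i.val + 1 < n),
          (∀ j, x i j m = false) → S ⟨i.val + 1, hi⟩ m = 0) →
        ∀ (m : M) (i : Fin n) (hi : i.val + 1 < n),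
          (∑ j : Fin n, (if x i j m = true then sminus j m else 0))
            ≤ S ⟨i.val + 1, hi⟩ m := by
  obtain ⟨hjob, hslot, hnext⟩ := hx
  have successor : ∀ (m : M) (i : Fin n) (hi : i.val + 1 < n) (k : Fin n), x i k m = true →
      ∃ j : Fin n, j ≠ k ∧ x ⟨i.val + 1, hi⟩ j m = true ∧ sminus k m ≤ s k j m := by
    intro m i hi k hk
    obtain ⟨j, hj⟩ := hnext m i hi ⟨k, hk⟩
    have hjk : j ≠ k := by
      rintro rfl
      have hp := (hjob j).unique (y₁ := (i, m)) (y₂ := (⟨i.val + 1, hi⟩, m)) hk hj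
      have hv := congrArg (fun p => p.1.val) hp
      simp at hv
    refine ⟨j, hjk, hj, ?_⟩
    rw [hsm]
    exact Finset.inf'_le (fun l => s k l m) (by simp [hjk])
  refine ⟨successor, fun S hS hS₀ m i hi => ?_⟩
  by_cases h : ∃ k, x i k m = true
  · obtain ⟨k, hk⟩ := h
    obtain ⟨j, -, hj, hle⟩ := successor m i hi k hk
    rw [Finset.sum_eq_single k
      (fun b _ hb => if_neg fun hbt => hb (hslot i m b k hbt hk)) (by simp), if_pos hk,
      hS m i hi k j hk hj]
    exact hle
  · have hempty : ∀ j, x i j m = false := by simpa using h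
    simp [hempty, hS₀ m i hi hempty]
end
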